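/- For every finite meet-semilattice S with least element 0 and greatest element 1 of order n ≥ 2, and every m ≥ 1, the number of inconsistent equations in at most m variables over S is at least (2^m − 1)·n(n−1)/2. -/

import Mathlib

/-- An equation of the first kind in at most `m` variables over a meet-semilattice `S`:
`(⊓_{i ∈ T} x_i) ⊓ s₁ = (⊓_{i ∈ U} x_i) ⊓ s₂` with `T, U` nonempty. -/
structure EqFst (S : Type*) (m : ℕ) where
  T : Finset (Fin m)
  hT : T.Nonempty
  s₁ : S
  U : Finset (Fin m)
  hU : U.Nonempty
  s₂ : S

/-- An equation of the second kind: `(⊓_{i ∈ T} x_i) ⊓ s₁ = s₂` with `T` nonempty. -/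
structure EqSnd (S : Type*) (m : ℕ) where
  T : Finset (Fin m)
  hT : T.Nonempty
  s₁ : S
  s₂ : S

def EqFst.HasSolution {S : Type*} [SemilatticeInf S] {m : ℕ} (e : EqFst S m) : Prop :=
  ∃ v : Fin m → S, (e.T.inf' e.hT v) ⊓ e.s₁ = (e.U.inf' e.hU v) ⊓ e.s₂

def EqSnd.HasSolution {S : Type*} [SemilatticeInf S] {m : ℕ} (e : EqSnd S m) : Prop :=
  ∃ v : Fin m → S, (e.T.inf' e.hT v) ⊓ e.s₁ = e.s₂

/-- The number of inconsistent equations (of both kinds) in at most `m` variables over `S`. -/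
noncomputable def numInconsistent (S : Type*) [SemilatticeInf S] (m : ℕ) : ℕ :=
  Nat.card {e : EqFst S m // ¬ e.HasSolution} + Nat.card {e : EqSnd S m // ¬ e.HasSolution}

theorem EqSnd.not_hasSolution_of_not_le {S : Type*} [SemilatticeInf S] {m : ℕ} (e : EqSnd S m)
    (h : ¬ e.s₂ ≤ e.s₁) : ¬ e.HasSolution := by
  rintro ⟨v, hv⟩
  exact h (hv ▸ inf_le_right)

theorem EqSnd.finite (S : Type*) [Finite S] (m : ℕ) : Finite (EqSnd S m) := by
  refine Finite.of_injective (β := Finset (Fin m) × S × S) (fun e => (e.T, e.s₁, e.s₂)) ?_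
  rintro ⟨T, hT, a, b⟩ ⟨T', hT', a', b'⟩ h
  simp only [Prod.mk.injEq] at h
  obtain ⟨rfl, rfl, rfl⟩ := h
  rfl

theorem card_mul_pred_div_two_le_card_not_le (S : Type*) [Fintype S] [PartialOrder S] :
    Fintype.card S * (Fintype.card S - 1) / 2 ≤ Nat.card {p : S × S // ¬ p.2 ≤ p.1} := by
  classical
  rw [Nat.card_eq_fintype_card, Fintype.card_subtype]
  set N : Finset (S × S) := {p | ¬ p.2 ≤ p.1}
  have hsub : (Finset.univ : Finset S).offDiag ⊆ N ∪ N.image Prod.swap := by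
    rintro ⟨a, b⟩ hab
    have hne : a ≠ b := by simpa using hab
    by_cases h : b ≤ a
    · have h' : ¬ a ≤ b := fun h' => hne (le_antisymm h' h)
      exact Finset.mem_union_right _ (Finset.mem_image.2 ⟨(b, a), by simpa [N] using h', rfl⟩)
    · exact Finset.mem_union_left _ (by simpa [N] using h)
  have hcard := (Finset.card_le_card hsub).trans (Finset.card_union_le _ _)
  have himage : (N.image Prod.swap).card ≤ N.card := Finset.card_image_le
  rw [Finset.offDiag_card, Finset.card_univ] at hcard
  rw [Nat.mul_sub_one]
  omega

theorem card_nonempty_finset (α : Type*) [Fintype α] :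
    Nat.card {T : Finset α // T.Nonempty} = 2 ^ Fintype.card α - 1 := by
  classical
  have h : (Finset.univ.filter fun T : Finset α => T.Nonempty) = Finset.univ.erase ∅ := by
    ext T
    simp [Finset.nonempty_iff_ne_empty]
  rw [Nat.card_eq_fintype_card, Fintype.card_subtype, h,
    Finset.card_erase_of_mem (Finset.mem_univ _), Finset.card_univ, Fintype.card_finset]

theorem stmt_0 (S : Type*) [Fintype S] [SemilatticeInf S] [OrderBot S] [OrderTop S]
    (hn : 2 ≤ Fintype.card S) (m : ℕ) (hm : 1 ≤ m) :
    (2 ^ m - 1) * (Fintype.card S * (Fintype.card S - 1) / 2) ≤ numInconsistent S m := by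
  have := EqSnd.finite S m
  let f : {T : Finset (Fin m) // T.Nonempty} × {p : S × S // ¬ p.2 ≤ p.1} →
      {e : EqSnd S m // ¬ e.HasSolution} := fun x =>
    ⟨⟨x.1.1, x.1.2, x.2.1.1, x.2.1.2⟩, EqSnd.not_hasSolution_of_not_le _ x.2.2⟩
  have hf : Function.Injective f := by
    rintro ⟨⟨T, hT⟩, ⟨⟨a, b⟩, hab⟩⟩ ⟨⟨T', hT'⟩, ⟨⟨a', b'⟩, hab'⟩⟩ h
    simp only [f, Subtype.mk.injEq, EqSnd.mk.injEq] at h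
    obtain ⟨rfl, rfl, rfl⟩ := h
    rfl
  have hle := Nat.card_le_card_of_injective f hf
  rw [Nat.card_prod, card_nonempty_finset, Fintype.card_fin] at hle
  calc (2 ^ m - 1) * (Fintype.card S * (Fintype.card S - 1) / 2)
      ≤ (2 ^ m - 1) * Nat.card {p : S × S // ¬ p.2 ≤ p.1} :=
        Nat.mul_le_mul_left _ (card_mul_pred_div_two_le_card_not_le S)
    _ ≤ Nat.card {e : EqSnd S m // ¬ e.HasSolution} := hle
    _ ≤ numInconsistent S m := Nat.le_add_left _ _
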